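/- Let G be a digraph with transitive closure Ḡ, let f̄ be a discrete Morse function on Ḡ, with V̄ = grad f̄ and Φ̄ = Id + ∂V̄ + V̄∂ on Ḡ. Suppose Ω_*(G) is V̄-invariant (V̄(Ω_n(G)) ⊆ Ω_{n+1}(G) for all n) and Φ̄(α) ∈ Ω(G) for every allowed elementary path α on G that is critical in Ḡ. Then for every m ≥ 0 the weak Morse inequality l_m ≥ b_m holds, where l_m = dim(Crit_m(Ḡ) ∩ P_m(G)) is the number of m-paths critical in Ḡ and allowed in G, and b_m = dim H_m(G;ℝ) is the m-th Betti number of the path homology of G. -/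

import Mathlib

open scoped BigOperators Classical

namespace PathMorse

/-- A digraph: an irreflexive edge relation on a vertex set. -/
structure Digraph (V : Type) where
  E : V → V → Prop
  irrefl : ∀ v, ¬ E v v

/-- A digraph is transitive if `u→v` and `v→w` imply `u→w`. -/
def Digraph.Transitive {V : Type} (G : Digraph V) : Prop :=
  ∀ u v w, G.E u v → G.E v w → G.E u w

/-- `Gbar` is the transitive closure of `G`: the smallest transitive digraph containing `G`. -/
def IsTransClosure {V : Type} (G Gbar : Digraph V) : Prop :=
  Gbar.Transitive ∧ (∀ u v, G.E u v → Gbar.E u v) ∧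
    ∀ H : Digraph V, H.Transitive → (∀ u v, G.E u v → H.E u v) →
      ∀ u v, Gbar.E u v → H.E u v

/-- An elementary `n`-path on `V`: a sequence of `n+1` vertices. -/
abbrev Path (V : Type) (n : ℕ) := Fin (n+1) → V

/-- An elementary path is allowed on `G` if consecutive vertices are joined by directed edges. -/
def Allowed {V : Type} (G : Digraph V) {n : ℕ} (p : Path V n) : Prop :=
  ∀ i : Fin n, G.E (p i.castSucc) (p i.succ)

/-- The `i`-th face of a path: delete the `i`-th vertex. -/
def face {V : Type} {n : ℕ} (i : Fin (n+2)) (p : Path V (n+1)) : Path V n :=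
  p ∘ i.succAbove

/-- `q` is obtained from `p` by deleting one vertex (the codimension-one relation `q < p`). -/
def IsFace {V : Type} {n : ℕ} (q : Path V n) (p : Path V (n+1)) : Prop :=
  ∃ i : Fin (n+2), face i p = q

/-- Value of `f` on a path: sum of the values at the vertices. -/
def fPath {V : Type} (f : V → ℝ) {n : ℕ} (p : Path V n) : ℝ :=
  ∑ i, f (p i)

/-- There is an allowed coface `γ > p` with `f γ = f p`. -/
def HasEqualCoface {V : Type} (G : Digraph V) (f : V → ℝ) {n : ℕ} (p : Path V n) : Prop :=
  ∃ γ : Path V (n+1), Allowed G γ ∧ IsFace p γ ∧ fPath f γ = fPath f p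

/-- There is an allowed face `β < p` with `f β = f p`. -/
def HasEqualFace {V : Type} (G : Digraph V) (f : V → ℝ) : (n : ℕ) → Path V n → Prop
  | 0, _ => False
  | (n+1), p => ∃ β : Path V n, Allowed G β ∧ IsFace β p ∧ fPath f β = fPath f p

/-- A discrete Morse function on a digraph: nonnegative, and for each allowed elementary path
there is at most one allowed coface with the same value, and at most one allowed face with the
same value. -/
def IsMorse {V : Type} (G : Digraph V) (f : V → ℝ) : Prop :=
  (∀ v, 0 ≤ f v) ∧
  (∀ n (α : Path V n), Allowed G α →
    ∀ γ₁ γ₂ : Path V (n+1), Allowed G γ₁ → Allowed G γ₂ → IsFace α γ₁ → IsFace α γ₂ →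
      fPath f γ₁ = fPath f α → fPath f γ₂ = fPath f α → γ₁ = γ₂) ∧
  (∀ n (α : Path V (n+1)), Allowed G α →
    ∀ β₁ β₂ : Path V n, Allowed G β₁ → Allowed G β₂ → IsFace β₁ α → IsFace β₂ α →
      fPath f β₁ = fPath f α → fPath f β₂ = fPath f α → β₁ = β₂)

/-- A critical path: allowed, with no allowed coface of equal value, no allowed face of equal value. -/
def IsCritical {V : Type} (G : Digraph V) (f : V → ℝ) {n : ℕ} (p : Path V n) : Prop :=
  Allowed G p ∧ ¬ HasEqualCoface G f p ∧ ¬ HasEqualFace G f n p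

/-- `n`-chains: the real vector space with (orthonormal) basis the elementary `n`-paths. -/
abbrev Chain (V : Type) (n : ℕ) := Path V n → ℝ

variable {V : Type} [Fintype V] [DecidableEq V]

/-- The basis chain corresponding to an elementary path. -/
def unitP {n : ℕ} (p : Path V n) : Chain V n := Pi.single p 1

/-- The boundary operator on chains (as a bare function). -/
def boundaryFun {n : ℕ} (x : Chain V (n+1)) : Chain V n :=
  fun q => ∑ p : Path V (n+1), x p * ∑ i : Fin (n+2), ((-1:ℝ)^(i:ℕ)) * (if face i p = q then 1 else 0)

/-- The boundary operator `∂ = Σ (-1)^i d_i` as a linear map. -/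
def boundary (V : Type) [Fintype V] [DecidableEq V] (n : ℕ) : Chain V (n+1) →ₗ[ℝ] Chain V n where
  toFun := boundaryFun
  map_add' x y := by
    funext q
    simp [boundaryFun, add_mul, Finset.sum_add_distrib]
  map_smul' c x := by
    funext q
    simp [boundaryFun, Finset.mul_sum, mul_assoc]

/-- `P_n(G)`: the span of the allowed elementary `n`-paths. -/
def pSpan (G : Digraph V) (n : ℕ) : Submodule ℝ (Chain V n) :=
  Submodule.span ℝ {x : Chain V n | ∃ p : Path V n, Allowed G p ∧ x = unitP p}

/-- `Ω_n(G) = {x ∈ P_n(G) : ∂x ∈ P_{n-1}(G)}` (with `Ω_0 = P_0`). -/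
def omega (G : Digraph V) : (n : ℕ) → Submodule ℝ (Chain V n)
  | 0 => pSpan G 0
  | (n+1) => pSpan G (n+1) ⊓ (pSpan G n).comap (boundary V n)

/-- The discrete gradient vector field on a basis path: `V(α) = -⟨∂γ,α⟩ γ` if there is an
allowed coface `γ > α` with `f γ = f α`, and `0` otherwise. -/
noncomputable def gradFun (G : Digraph V) (f : V → ℝ) {n : ℕ} (α : Path V n) : Chain V (n+1) :=
  if h : Allowed G α ∧ ∃ γ : Path V (n+1), Allowed G γ ∧ IsFace α γ ∧ fPath f γ = fPath f α then
    (-(boundary V n (unitP h.2.choose) α)) • unitP h.2.choose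
  else 0

/-- The discrete gradient vector field `V = grad f`, extended linearly to chains. -/
noncomputable def grad (G : Digraph V) (f : V → ℝ) (n : ℕ) : Chain V n →ₗ[ℝ] Chain V (n+1) where
  toFun x := ∑ α : Path V n, x α • gradFun G f α
  map_add' x y := by simp [add_smul, Finset.sum_add_distrib]
  map_smul' c x := by simp [Finset.smul_sum, smul_smul]

/-- The composite `V∂` in degree `n` (zero in degree `0`). -/
noncomputable def vd (G : Digraph V) (f : V → ℝ) : (n : ℕ) → (Chain V n →ₗ[ℝ] Chain V n)
  | 0 => 0
  | (n+1) => (grad G f n).comp (boundary V n)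

/-- The discrete gradient flow `Φ = Id + ∂V + V∂`. -/
noncomputable def flow (G : Digraph V) (f : V → ℝ) (n : ℕ) : Chain V n →ₗ[ℝ] Chain V n :=
  LinearMap.id + (boundary V n).comp (grad G f n) + vd G f n

/-- `P_n^Φ(G) = {x ∈ P_n(G) : Φ x = x}`. -/
noncomputable def pPhi (G : Digraph V) (f : V → ℝ) (n : ℕ) : Submodule ℝ (Chain V n) :=
  pSpan G n ⊓ LinearMap.ker (flow G f n - LinearMap.id)

/-- The cycles of a chain complex of subspaces `C` with differentials `D`
(in degree `0`, everything is a cycle). -/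
def cycles (C : ∀ n, Submodule ℝ (Chain V n)) (D : ∀ n, Chain V (n+1) →ₗ[ℝ] Chain V n) :
    (m : ℕ) → Submodule ℝ (Chain V m)
  | 0 => C 0
  | (m+1) => C (m+1) ⊓ LinearMap.ker (D m)

/-- Homology of the chain complex `(C, D)`: cycles modulo boundaries coming from `C`. -/
abbrev Homology (C : ∀ n, Submodule ℝ (Chain V n)) (D : ∀ n, Chain V (n+1) →ₗ[ℝ] Chain V n)
    (m : ℕ) :=
  (cycles C D m) ⧸ (Submodule.comap (cycles C D m).subtype ((C (m+1)).map (D m)))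

/-- The operator `e^{tf}` on chains. -/
noncomputable def expOp (f : V → ℝ) (t : ℝ) (n : ℕ) : Chain V n →ₗ[ℝ] Chain V n where
  toFun x := fun p => Real.exp (t * fPath f p) * x p
  map_add' x y := by funext p; simp [mul_add]
  map_smul' c x := by funext p; simp; ring

/-- The deformed boundary `∂_t = e^{tf} ∂ e^{-tf}`. -/
noncomputable def dT (f : V → ℝ) (t : ℝ) (n : ℕ) : Chain V (n+1) →ₗ[ℝ] Chain V n :=
  (expOp f t n).comp ((boundary V n).comp (expOp f (-t) (n+1)))

/-- The span of the elementary `n`-paths that are critical in `Gbar` and allowed in `G`. -/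
def critSpan (G Gbar : Digraph V) (f : V → ℝ) (n : ℕ) : Submodule ℝ (Chain V n) :=
  Submodule.span ℝ {x : Chain V n | ∃ α : Path V n, IsCritical Gbar f α ∧ Allowed G α ∧ x = unitP α}

section Boundary

theorem boundary_unitP {n : ℕ} (p : Path V (n+1)) :
    boundary V n (unitP p) = ∑ i : Fin (n+2), ((-1:ℝ)^(i:ℕ)) • unitP (face i p) := by
  funext q
  change boundaryFun (unitP p) q = _
  rw [boundaryFun, Finset.sum_eq_single p]
  · simp [unitP, Finset.sum_apply, Pi.single_apply, eq_comm]
  · intro b _ hb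
    simp [unitP, hb]
  · simp

theorem chain_eq_sum {n : ℕ} (x : Chain V n) : x = ∑ p : Path V n, x p • unitP p := by
  funext q
  simp [unitP, Finset.sum_apply, Pi.single_apply]

theorem boundary_boundary_unitP {n : ℕ} (p : Path V (n+2)) :
    boundary V n (boundary V (n+1) (unitP p)) = 0 := by
  rw [boundary_unitP, map_sum]
  simp only [map_smul, boundary_unitP, Finset.smul_sum, smul_smul]
  rw [← Fintype.sum_prod_type'
    (f := fun (i : Fin (n+3)) (j : Fin (n+2)) =>
      ((-1:ℝ)^(i:ℕ) * (-1:ℝ)^(j:ℕ)) • (unitP (face j (face i p)) : Chain V n))]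
  refine Finset.sum_involution (fun x _ => (x.1.succAbove x.2, x.2.predAbove x.1)) ?_ ?_ ?_ ?_
  · rintro ⟨i, j⟩ -
    have hface : face (j.predAbove i) (face (i.succAbove j) p) = face j (face i p) := by
      funext k
      simp only [face, Function.comp_apply]
      rw [Fin.succAbove_succAbove_succAbove_predAbove]
    have hsign : (-1:ℝ)^((i.succAbove j : Fin (n+3)):ℕ) * (-1:ℝ)^((j.predAbove i : Fin (n+2)):ℕ)
        = -((-1:ℝ)^(i:ℕ) * (-1:ℝ)^(j:ℕ)) := by
      rw [← pow_add, ← pow_add, Fin.neg_one_pow_succAbove_add_predAbove]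
    simp only [hface, hsign, neg_smul, add_neg_cancel]
  · rintro ⟨i, j⟩ - - h
    exact Fin.succAbove_ne i j (congrArg Prod.fst h)
  · simp
  · rintro ⟨i, j⟩ -
    simp [Fin.succAbove_succAbove_predAbove, Fin.predAbove_predAbove_succAbove]

theorem boundary_boundary {n : ℕ} (x : Chain V (n+2)) :
    boundary V n (boundary V (n+1) x) = 0 := by
  rw [chain_eq_sum x]
  simp [map_sum, boundary_boundary_unitP]

end Boundary

theorem Allowed.lt {V : Type} {G : Digraph V} (hG : G.Transitive) {n : ℕ} {p : Path V n}
    (hp : Allowed G p) {i j : Fin (n+1)} (hij : i < j) : G.E (p i) (p j) := by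
  have : IsTrans V G.E := ⟨hG⟩
  exact (Fin.liftFun_iff_succ (f := p) G.E).2 hp hij

theorem Allowed.injective {V : Type} {G : Digraph V} (hG : G.Transitive) {n : ℕ} {p : Path V n}
    (hp : Allowed G p) : Function.Injective p := by
  intro i j hij
  by_contra hne
  rcases lt_or_gt_of_ne hne with h | h
  · exact G.irrefl _ (hij ▸ hp.lt hG h)
  · exact G.irrefl _ (hij ▸ hp.lt hG h)

theorem Allowed.face {V : Type} {G : Digraph V} (hG : G.Transitive) {n : ℕ} {p : Path V (n+1)}
    (hp : Allowed G p) (i : Fin (n+2)) : Allowed G (face i p) := fun k =>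
  hp.lt hG (Fin.strictMono_succAbove i k.castSucc_lt_succ)

theorem face_injective {V : Type} {n : ℕ} {p : Path V (n+1)} (hp : Function.Injective p) :
    Function.Injective (fun i => face i p) := by
  intro i j hij
  by_contra hne
  obtain ⟨k, hk⟩ := Fin.exists_succAbove_eq (x := i) (y := j) hne
  have := congrFun hij k
  simp only [face, Function.comp_apply, hk] at this
  exact Fin.succAbove_ne i k (hp this)

theorem fPath_eq_add_face {V : Type} (f : V → ℝ) {n : ℕ} (p : Path V (n+1)) (i : Fin (n+2)) :
    fPath f p = f (p i) + fPath f (face i p) :=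
  Fin.sum_univ_succAbove (fun k => f (p k)) i

theorem fPath_eq_fPath_face_iff {V : Type} (f : V → ℝ) {n : ℕ} (p : Path V (n+1))
    (i : Fin (n+2)) : fPath f p = fPath f (face i p) ↔ f (p i) = 0 := by
  rw [fPath_eq_add_face f p i, add_eq_right]

theorem IsMorse.zero_unique {V : Type} {G : Digraph V} (hG : G.Transitive) {f : V → ℝ}
    (hf : IsMorse G f) {n : ℕ} {p : Path V (n+1)} (hp : Allowed G p) {i j : Fin (n+2)}
    (hi : f (p i) = 0) (hj : f (p j) = 0) : i = j :=
  face_injective (hp.injective hG) <|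
    hf.2.2 n p hp _ _ (hp.face hG i) (hp.face hG j) ⟨i, rfl⟩ ⟨j, rfl⟩
      ((fPath_eq_fPath_face_iff f p i).2 hi).symm ((fPath_eq_fPath_face_iff f p j).2 hj).symm

theorem IsMorse.not_hasEqualCoface {V : Type} {G : Digraph V} (hG : G.Transitive) {f : V → ℝ}
    (hf : IsMorse G f) {n : ℕ} {p : Path V n} {k : Fin (n+1)} (hk : f (p k) = 0) :
    ¬ HasEqualCoface G f p := by
  rintro ⟨γ, hγ, ⟨j, rfl⟩, hval⟩
  exact Fin.succAbove_ne j k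
    (hf.zero_unique hG hγ hk ((fPath_eq_fPath_face_iff f γ j).1 hval))

section Gradient

variable {G : Digraph V} {f : V → ℝ}

theorem grad_unitP {n : ℕ} (p : Path V n) : grad G f n (unitP p) = gradFun G f p := by
  change ∑ α : Path V n, (unitP p : Chain V n) α • gradFun G f α = _
  rw [Finset.sum_eq_single p]
  · simp [unitP]
  · intro b _ hb
    simp [unitP, hb]
  · simp

theorem gradFun_eq_zero {n : ℕ} {p : Path V n} (hp : ¬ HasEqualCoface G f p) :
    gradFun G f p = 0 :=
  dif_neg fun h => hp h.2

theorem boundary_unitP_apply_face {n : ℕ} {p : Path V (n+1)} (hp : Function.Injective p)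
    (i : Fin (n+2)) : boundary V n (unitP p) (face i p) = (-1:ℝ)^(i:ℕ) := by
  rw [boundary_unitP, Finset.sum_apply, Finset.sum_eq_single i]
  · simp [unitP]
  · intro j _ hj
    have : face i p ≠ face j p := fun h => hj (face_injective hp h).symm
    simp [unitP, this]
  · simp

theorem gradFun_face (hG : G.Transitive) (hf : IsMorse G f) {n : ℕ} {p : Path V (n+1)}
    (hp : Allowed G p) {i : Fin (n+2)} (hi : f (p i) = 0) :
    gradFun G f (face i p) = (-(-1:ℝ)^(i:ℕ)) • unitP p := by
  have hval := (fPath_eq_fPath_face_iff f p i).2 hi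
  have h : Allowed G (face i p) ∧ ∃ γ : Path V (n+1), Allowed G γ ∧ IsFace (face i p) γ ∧
      fPath f γ = fPath f (face i p) := ⟨hp.face hG i, p, hp, ⟨i, rfl⟩, hval⟩
  have hc : h.2.choose = p :=
    hf.2.1 n _ h.1 _ _ h.2.choose_spec.1 hp h.2.choose_spec.2.1 ⟨i, rfl⟩
      h.2.choose_spec.2.2 hval
  rw [gradFun, dif_pos h, hc, boundary_unitP_apply_face (hp.injective hG)]

theorem flow_succ_apply {n : ℕ} (x : Chain V (n+1)) :
    flow G f (n+1) x = x + boundary V (n+1) (grad G f (n+1) x) + grad G f n (boundary V n x) :=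
  rfl

theorem flow_boundary {n : ℕ} (x : Chain V (n+1)) :
    flow G f n (boundary V n x) = boundary V n (flow G f (n+1) x) := by
  rw [flow_succ_apply, map_add, map_add, boundary_boundary, add_zero]
  cases n with
  | zero => simp [flow, vd]
  | succ n => rw [flow_succ_apply, boundary_boundary, map_zero, add_zero]

/-- The flow annihilates paths of positive length through a zero of the Morse function. -/
theorem flow_unitP_of_zero (hG : G.Transitive) (hf : IsMorse G f) {n : ℕ} {p : Path V (n+1)}
    (hp : Allowed G p) {i : Fin (n+2)} (hi : f (p i) = 0) : flow G f (n+1) (unitP p) = 0 := by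
  rw [flow_succ_apply, grad_unitP, gradFun_eq_zero (hf.not_hasEqualCoface hG hi), map_zero,
    add_zero, boundary_unitP, map_sum, Finset.sum_eq_single i]
  · rw [map_smul, grad_unitP, gradFun_face hG hf hp hi, smul_smul, mul_neg, ← pow_add,
      Even.neg_one_pow ⟨_, rfl⟩, neg_one_smul, add_neg_cancel]
  · intro j _ hj
    obtain ⟨k, hk⟩ := Fin.exists_succAbove_eq (x := i) (y := j) hj.symm
    have hz : f (face j p k) = 0 := by rw [face, Function.comp_apply, hk, hi]
    rw [map_smul, grad_unitP, gradFun_eq_zero (hf.not_hasEqualCoface hG hz), smul_zero]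
  · simp

theorem sum_flow_face_eq_zero (hG : G.Transitive) (hf : IsMorse G f) {n : ℕ}
    {p : Path V (n+1)} (hp : Allowed G p) {i : Fin (n+2)} (hi : f (p i) = 0) :
    ∑ j : Fin (n+2), ((-1:ℝ)^(j:ℕ)) • flow G f n (unitP (face j p)) = 0 := by
  have h := flow_boundary (G := G) (f := f) (unitP p)
  rw [flow_unitP_of_zero hG hf hp hi, map_zero, boundary_unitP, map_sum] at h
  simpa only [map_smul] using h

theorem flow_unitP_of_not_isCritical (hG : G.Transitive) (hf : IsMorse G f) {n : ℕ}
    {p : Path V (n+1)} (hp : Allowed G p) (hc : ¬ IsCritical G f p) :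
    flow G f (n+1) (unitP p) = 0 := by
  by_cases hface : HasEqualFace G f (n+1) p
  · obtain ⟨β, -, ⟨i, rfl⟩, hval⟩ := hface
    exact flow_unitP_of_zero hG hf hp ((fPath_eq_fPath_face_iff f p i).1 hval.symm)
  · have hco : HasEqualCoface G f p := by
      by_contra h
      exact hc ⟨hp, h, hface⟩
    obtain ⟨γ, hγ, ⟨i, rfl⟩, hval⟩ := hco
    have hi := (fPath_eq_fPath_face_iff f γ i).1 hval
    have hsum := sum_flow_face_eq_zero hG hf hγ hi
    rw [Finset.sum_eq_single i] at hsum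
    · exact (smul_eq_zero.1 hsum).resolve_left (pow_ne_zero _ (by norm_num))
    · intro j _ hj
      obtain ⟨k, hk⟩ := Fin.exists_succAbove_eq (x := i) (y := j) hj.symm
      have hz : f (face j γ k) = 0 := by rw [face, Function.comp_apply, hk, hi]
      rw [flow_unitP_of_zero hG hf (hγ.face hG j) hz, smul_zero]
    · simp

theorem exists_isCritical_flow_eq (hG : G.Transitive) (hf : IsMorse G f)
    {p : Path V 0} (hp : Allowed G p) :
    ∃ q : Path V 0, IsCritical G f q ∧ flow G f 0 (unitP p) = flow G f 0 (unitP q) := by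
  by_cases hco : HasEqualCoface G f p
  · obtain ⟨γ, hγ, ⟨i, rfl⟩, hval⟩ := hco
    have hi := (fPath_eq_fPath_face_iff f γ i).1 hval
    have hsum := sum_flow_face_eq_zero hG hf hγ hi
    have hz : f (face (i + 1) γ 0) = 0 := by
      rw [← hi]
      fin_cases i <;> rfl
    refine ⟨face (i + 1) γ, ⟨hγ.face hG _, hf.not_hasEqualCoface hG hz, id⟩, ?_⟩
    rw [Fin.sum_univ_two] at hsum
    have h01 : flow G f 0 (unitP (face 0 γ)) = flow G f 0 (unitP (face 1 γ)) := by
      simpa [add_neg_eq_zero] using hsum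
    fin_cases i
    · exact h01
    · exact h01.symm
  · exact ⟨p, ⟨hp, hco, id⟩, rfl⟩

/-- On chains of `P_n(H)`, the flow takes values in the span of the flows of the critical paths
allowed in `H`. -/
theorem flow_mem_span {H : Digraph V} (hHG : ∀ u v, H.E u v → G.E u v) (hG : G.Transitive)
    (hf : IsMorse G f) {n : ℕ} {x : Chain V n} (hx : x ∈ pSpan H n) :
    flow G f n x ∈ Submodule.span ℝ (Set.range
      fun p : {p : Path V n // IsCritical G f p ∧ Allowed H p} => flow G f n (unitP p.1)) := by
  induction hx using Submodule.span_induction with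
  | zero => simp
  | add x y _ _ hx hy => rw [map_add]; exact add_mem hx hy
  | smul c x _ hx => rw [map_smul]; exact Submodule.smul_mem _ c hx
  | mem x hx =>
    obtain ⟨p, hp, rfl⟩ := hx
    have hpG : Allowed G p := fun i => hHG _ _ (hp i)
    cases n with
    | zero =>
      obtain ⟨q, hq, hpq⟩ := exists_isCritical_flow_eq hG hf hpG
      rw [hpq]
      exact Submodule.subset_span ⟨⟨q, hq, fun i => i.elim0⟩, rfl⟩
    | succ n =>
      by_cases hc : IsCritical G f p
      · exact Submodule.subset_span ⟨⟨p, hc, hp⟩, rfl⟩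
      · rw [flow_unitP_of_not_isCritical hG hf hpG hc]
        exact zero_mem _

theorem omega_le_pSpan (H : Digraph V) (n : ℕ) : omega H n ≤ pSpan H n := by
  cases n with
  | zero => exact le_rfl
  | succ n => exact inf_le_left

theorem cycles_le {V : Type} (C : ∀ n, Submodule ℝ (Chain V n)) (D : ∀ n, Chain V (n+1) →ₗ[ℝ] Chain V n)
    (m : ℕ) : cycles C D m ≤ C m := by
  cases m with
  | zero => exact le_rfl
  | succ m => exact inf_le_left

theorem flow_eq_of_mem_cycles {C : ∀ n, Submodule ℝ (Chain V n)} {m : ℕ} {z : Chain V m}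
    (hz : z ∈ cycles C (fun n => boundary V n) m) :
    flow G f m z = z + boundary V m (grad G f m z) := by
  cases m with
  | zero => simp [flow, vd]
  | succ m => rw [flow_succ_apply, LinearMap.mem_ker.1 hz.2, map_zero, add_zero]

end Gradient

theorem finrank_quotient_comap_subtype_le {E : Type*} [AddCommGroup E] [Module ℝ E]
    [FiniteDimensional ℝ E] {Z B W : Submodule ℝ E} (h : Z ≤ B ⊔ W) :
    Module.finrank ℝ (Z ⧸ B.comap Z.subtype) ≤ Module.finrank ℝ W := by
  have hker : B.comap Z.subtype = LinearMap.ker (B.mkQ ∘ₗ Z.subtype) := by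
    rw [LinearMap.ker_comp, Submodule.ker_mkQ]
  have hrange : LinearMap.range (B.mkQ ∘ₗ Z.subtype) ≤ W.map B.mkQ := by
    rw [LinearMap.range_comp, Submodule.range_subtype]
    refine (Submodule.map_mono h).trans ?_
    rw [Submodule.map_sup, Submodule.mkQ_map_self, bot_sup_eq]
  rw [hker, (LinearMap.quotKerEquivRange (B.mkQ ∘ₗ Z.subtype)).finrank_eq]
  exact (Submodule.finrank_mono hrange).trans (Submodule.finrank_map_le _ _)

/-- Weak Morse inequalities on digraphs: `l_m ≥ b_m`, where `l_m` is the number of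
`m`-paths critical in `Ḡ` and allowed in `G`, and `b_m` is the `m`-th Betti number of the path
homology of `G`. -/
theorem stmt18 {V : Type} [Fintype V] [DecidableEq V] (G Gbar : Digraph V)
    (hcl : IsTransClosure G Gbar) (f : V → ℝ) (hf : IsMorse Gbar f)
    (hinv : ∀ n, ∀ x ∈ omega G n, grad Gbar f n x ∈ omega G (n+1))
    (hflow : ∀ (n : ℕ) (α : Path V n), Allowed G α → IsCritical Gbar f α →
      flow Gbar f n (unitP α) ∈ omega G n) :
    ∀ m : ℕ, Module.finrank ℝ (Homology (omega G) (fun n => boundary V n) m) ≤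
      Nat.card {p : Path V m // IsCritical Gbar f p ∧ Allowed G p} := by
  intro m
  refine (finrank_quotient_comap_subtype_le (W := Submodule.span ℝ (Set.range
    fun p : {p : Path V m // IsCritical Gbar f p ∧ Allowed G p} =>
      flow Gbar f m (unitP p.1))) ?_).trans ?_
  · intro z hz
    have hzΩ : z ∈ omega G m := cycles_le _ _ _ hz
    have hdecomp : z = -boundary V m (grad Gbar f m z) + flow Gbar f m z := by
      rw [flow_eq_of_mem_cycles hz]
      abel
    rw [hdecomp]
    exact Submodule.add_mem_sup
      (neg_mem (Submodule.mem_map_of_mem (hinv m z hzΩ)))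
      (flow_mem_span hcl.2.1 hcl.1 hf (omega_le_pSpan G m hzΩ))
  · rw [Nat.card_eq_fintype_card]
    exact finrank_range_le_card _

end PathMorse
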